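/- The cut rule is admissible in the sequent calculus G(KD_n): if Γ ⇒ Δ, A and A, Γ' ⇒ Δ' are derivable, then Γ, Γ' ⇒ Δ, Δ' is derivable. -/

import Mathlib

namespace UIP

/-- Multi-agent modal formulas over agent type `α`, with variables, `⊥`,
`∧`, `∨`, `→`, `¬`, and a box `□_i` for each agent `i`. -/
inductive Formula (α : Type) : Type where
  | var : ℕ → Formula α
  | bot : Formula α
  | and : Formula α → Formula α → Formula α
  | or  : Formula α → Formula α → Formula α
  | imp : Formula α → Formula α → Formula α
  | neg : Formula α → Formula α
  | box : α → Formula α → Formula α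
  deriving DecidableEq

namespace Formula

variable {α : Type}

/-- The weight of a formula. -/
def weight : Formula α → ℕ
  | var _ => 1
  | bot => 1
  | and A B => weight A + weight B + 1
  | or A B => weight A + weight B + 1
  | imp A B => weight A + weight B + 1
  | neg A => weight A + 1
  | box _ A => weight A + 1

/-- The set of propositional variables occurring in a formula. -/
def vars : Formula α → Finset ℕ
  | var p => {p}
  | bot => ∅
  | and A B => vars A ∪ vars B
  | or A B => vars A ∪ vars B
  | imp A B => vars A ∪ vars B
  | neg A => vars A
  | box _ A => vars A

/-- A formula is atomic iff it is a propositional variable or `⊥`. -/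
def isAtomic : Formula α → Prop
  | var _ => True
  | bot => True
  | _ => False

/-- A formula is outermost-boxed. -/
def isBoxed : Formula α → Prop
  | box _ _ => True
  | _ => False

/-- A formula is outermost-boxed with a modality different from `□_i`. -/
def isBoxedNe (i : α) : Formula α → Prop
  | box j _ => j ≠ i
  | _ => False

/-- Substitution of the formula `B` for the variable `q`. -/
def subst (q : ℕ) (B : Formula α) : Formula α → Formula α
  | var p => if p = q then B else var p
  | bot => bot
  | and A C => and (subst q B A) (subst q B C)
  | or A C => or (subst q B A) (subst q B C)
  | imp A C => imp (subst q B A) (subst q B C)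
  | neg A => neg (subst q B A)
  | box i A => box i (subst q B A)

/-- The set of boxed subformulas of a formula. -/
def boxedSubs [DecidableEq α] : Formula α → Finset (Formula α)
  | var _ => ∅
  | bot => ∅
  | and A B => boxedSubs A ∪ boxedSubs B
  | or A B => boxedSubs A ∪ boxedSubs B
  | imp A B => boxedSubs A ∪ boxedSubs B
  | neg A => boxedSubs A
  | box i A => insert (box i A) (boxedSubs A)

/-- Boolean evaluation of a formula under a valuation treating variables and
outermost-boxed formulas as atoms (used to define classical tautologies). -/
def evalB (v : Formula α → Bool) : Formula α → Bool
  | var p => v (var p)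
  | bot => false
  | and A B => evalB v A && evalB v B
  | or A B => evalB v A || evalB v B
  | imp A B => !evalB v A || evalB v B
  | neg A => !evalB v A
  | box i A => v (box i A)

end Formula

/-- A classical propositional tautology (boxed formulas treated as atoms). -/
def Tautology {α : Type} (A : Formula α) : Prop :=
  ∀ v : Formula α → Bool, A.evalB v = true

/-- The set of propositional variables occurring in a multiset of formulas. -/
def mVars {α : Type} (Γ : Multiset (Formula α)) : Finset ℕ :=
  (Γ.map Formula.vars).sup

/-- The total weight of a multiset of formulas. -/
def mWt {α : Type} (Γ : Multiset (Formula α)) : ℕ :=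
  (Γ.map Formula.weight).sum

/-- The number of boxed subformulas of the set underlying a multiset
(counted without multiplicity). -/
def bCount {α : Type} [DecidableEq α] (Γ : Multiset (Formula α)) : ℕ :=
  (Γ.toFinset.sup Formula.boxedSubs).card

/-- Hilbert systems `H(K_n)` (`d = t = false`), `H(KD_n)` (`d = true`) and
`H(KT_n)` (`t = true`): all classical tautologies, the K axiom, optionally
seriality `¬□_i ⊥` / reflexivity `□_i A → A`, modus ponens, necessitation. -/
inductive Hil {α : Type} (d t : Bool) : Formula α → Prop
  | taut {A : Formula α} : Tautology A → Hil d t A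
  | axK (i : α) (A B : Formula α) :
      Hil d t (((A.imp B).box i).imp ((A.box i).imp (B.box i)))
  | axD (i : α) : d = true → Hil d t ((Formula.bot.box i).neg)
  | axT (i : α) (A : Formula α) : t = true → Hil d t ((A.box i).imp A)
  | mp {A B : Formula α} : Hil d t (A.imp B) → Hil d t A → Hil d t B
  | nec (i : α) {A : Formula α} : Hil d t A → Hil d t (A.box i)

/-- The sequent calculi `G(K_n)` (`d = t = false`), `G(KD_n)` (`d = true`),
`G(KT_n)` (`t = true`) on sequents of finite multisets. -/
inductive G {α : Type} (d t : Bool) :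
    Multiset (Formula α) → Multiset (Formula α) → Prop
  | axId (p : ℕ) (Γ Δ : Multiset (Formula α)) :
      G d t (Formula.var p ::ₘ Γ) (Formula.var p ::ₘ Δ)
  | axBot (Γ Δ : Multiset (Formula α)) : G d t (Formula.bot ::ₘ Γ) Δ
  | andR {Γ Δ : Multiset (Formula α)} {A B : Formula α} :
      G d t Γ (A ::ₘ Δ) → G d t Γ (B ::ₘ Δ) → G d t Γ (A.and B ::ₘ Δ)
  | andL {Γ Δ : Multiset (Formula α)} {A B : Formula α} :
      G d t (A ::ₘ B ::ₘ Γ) Δ → G d t (A.and B ::ₘ Γ) Δ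
  | orR {Γ Δ : Multiset (Formula α)} {A B : Formula α} :
      G d t Γ (A ::ₘ B ::ₘ Δ) → G d t Γ (A.or B ::ₘ Δ)
  | orL {Γ Δ : Multiset (Formula α)} {A B : Formula α} :
      G d t (A ::ₘ Γ) Δ → G d t (B ::ₘ Γ) Δ → G d t (A.or B ::ₘ Γ) Δ
  | impR {Γ Δ : Multiset (Formula α)} {A B : Formula α} :
      G d t (A ::ₘ Γ) (B ::ₘ Δ) → G d t Γ (A.imp B ::ₘ Δ)
  | impL {Γ Δ : Multiset (Formula α)} {A B : Formula α} :
      G d t Γ (A ::ₘ Δ) → G d t (B ::ₘ Γ) Δ → G d t (A.imp B ::ₘ Γ) Δ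
  | negR {Γ Δ : Multiset (Formula α)} {A : Formula α} :
      G d t (A ::ₘ Γ) Δ → G d t Γ (A.neg ::ₘ Δ)
  | negL {Γ Δ : Multiset (Formula α)} {A : Formula α} :
      G d t Γ (A ::ₘ Δ) → G d t (A.neg ::ₘ Γ) Δ
  | boxK (i : α) {Γ : Multiset (Formula α)} {A : Formula α}
      (Sg Ω : Multiset (Formula α)) :
      (∀ C ∈ Sg, C.isAtomic ∨ C.isBoxedNe i) →
      (∀ C ∈ Ω, C.isAtomic ∨ C.isBoxed) →
      G d t Γ {A} →
      G d t (Sg + Γ.map (Formula.box i)) (Formula.box i A ::ₘ Ω)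
  | boxD (i : α) {Γ : Multiset (Formula α)} (Sg Ω : Multiset (Formula α)) :
      d = true → Γ ≠ 0 →
      (∀ C ∈ Sg, C.isAtomic ∨ C.isBoxedNe i) →
      (∀ C ∈ Ω, C.isAtomic ∨ C.isBoxed) →
      G d t Γ 0 →
      G d t (Sg + Γ.map (Formula.box i)) Ω
  | boxT (i : α) {Γ Δ : Multiset (Formula α)} {A : Formula α} :
      t = true →
      G d t (Formula.box i A ::ₘ A ::ₘ Γ) Δ →
      G d t (Formula.box i A ::ₘ Γ) Δ

/-- Height-indexed version of `G(K_n)`: `GH n Γ Δ` means `Γ ⇒ Δ` has a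
derivation of height at most `n` (initial sequents at every height,
each rule adds one to the height). -/
inductive GH {α : Type} : ℕ → Multiset (Formula α) → Multiset (Formula α) → Prop
  | axId (n : ℕ) (p : ℕ) (Γ Δ : Multiset (Formula α)) :
      GH n (Formula.var p ::ₘ Γ) (Formula.var p ::ₘ Δ)
  | axBot (n : ℕ) (Γ Δ : Multiset (Formula α)) : GH n (Formula.bot ::ₘ Γ) Δ
  | andR {n : ℕ} {Γ Δ : Multiset (Formula α)} {A B : Formula α} :
      GH n Γ (A ::ₘ Δ) → GH n Γ (B ::ₘ Δ) → GH (n + 1) Γ (A.and B ::ₘ Δ)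
  | andL {n : ℕ} {Γ Δ : Multiset (Formula α)} {A B : Formula α} :
      GH n (A ::ₘ B ::ₘ Γ) Δ → GH (n + 1) (A.and B ::ₘ Γ) Δ
  | orR {n : ℕ} {Γ Δ : Multiset (Formula α)} {A B : Formula α} :
      GH n Γ (A ::ₘ B ::ₘ Δ) → GH (n + 1) Γ (A.or B ::ₘ Δ)
  | orL {n : ℕ} {Γ Δ : Multiset (Formula α)} {A B : Formula α} :
      GH n (A ::ₘ Γ) Δ → GH n (B ::ₘ Γ) Δ → GH (n + 1) (A.or B ::ₘ Γ) Δ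
  | impR {n : ℕ} {Γ Δ : Multiset (Formula α)} {A B : Formula α} :
      GH n (A ::ₘ Γ) (B ::ₘ Δ) → GH (n + 1) Γ (A.imp B ::ₘ Δ)
  | impL {n : ℕ} {Γ Δ : Multiset (Formula α)} {A B : Formula α} :
      GH n Γ (A ::ₘ Δ) → GH n (B ::ₘ Γ) Δ → GH (n + 1) (A.imp B ::ₘ Γ) Δ
  | negR {n : ℕ} {Γ Δ : Multiset (Formula α)} {A : Formula α} :
      GH n (A ::ₘ Γ) Δ → GH (n + 1) Γ (A.neg ::ₘ Δ)
  | negL {n : ℕ} {Γ Δ : Multiset (Formula α)} {A : Formula α} :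
      GH n Γ (A ::ₘ Δ) → GH (n + 1) (A.neg ::ₘ Γ) Δ
  | boxK {n : ℕ} (i : α) {Γ : Multiset (Formula α)} {A : Formula α}
      (Sg Ω : Multiset (Formula α)) :
      (∀ C ∈ Sg, C.isAtomic ∨ C.isBoxedNe i) →
      (∀ C ∈ Ω, C.isAtomic ∨ C.isBoxed) →
      GH n Γ {A} →
      GH (n + 1) (Sg + Γ.map (Formula.box i)) (Formula.box i A ::ₘ Ω)

/-- The premise-of relation for backward proof-search in `G(K_n)`:
`GKPrem S S'` holds iff `S` is a premise of a rule instance of `G(K_n)`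
with conclusion `S'`. -/
inductive GKPrem {α : Type} :
    Multiset (Formula α) × Multiset (Formula α) →
    Multiset (Formula α) × Multiset (Formula α) → Prop
  | andR1 (Γ Δ : Multiset (Formula α)) (A B : Formula α) :
      GKPrem (Γ, A ::ₘ Δ) (Γ, A.and B ::ₘ Δ)
  | andR2 (Γ Δ : Multiset (Formula α)) (A B : Formula α) :
      GKPrem (Γ, B ::ₘ Δ) (Γ, A.and B ::ₘ Δ)
  | andL (Γ Δ : Multiset (Formula α)) (A B : Formula α) :
      GKPrem (A ::ₘ B ::ₘ Γ, Δ) (A.and B ::ₘ Γ, Δ)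
  | orR (Γ Δ : Multiset (Formula α)) (A B : Formula α) :
      GKPrem (Γ, A ::ₘ B ::ₘ Δ) (Γ, A.or B ::ₘ Δ)
  | orL1 (Γ Δ : Multiset (Formula α)) (A B : Formula α) :
      GKPrem (A ::ₘ Γ, Δ) (A.or B ::ₘ Γ, Δ)
  | orL2 (Γ Δ : Multiset (Formula α)) (A B : Formula α) :
      GKPrem (B ::ₘ Γ, Δ) (A.or B ::ₘ Γ, Δ)
  | impR (Γ Δ : Multiset (Formula α)) (A B : Formula α) :
      GKPrem (A ::ₘ Γ, B ::ₘ Δ) (Γ, A.imp B ::ₘ Δ)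
  | impL1 (Γ Δ : Multiset (Formula α)) (A B : Formula α) :
      GKPrem (Γ, A ::ₘ Δ) (A.imp B ::ₘ Γ, Δ)
  | impL2 (Γ Δ : Multiset (Formula α)) (A B : Formula α) :
      GKPrem (B ::ₘ Γ, Δ) (A.imp B ::ₘ Γ, Δ)
  | negR (Γ Δ : Multiset (Formula α)) (A : Formula α) :
      GKPrem (A ::ₘ Γ, Δ) (Γ, A.neg ::ₘ Δ)
  | negL (Γ Δ : Multiset (Formula α)) (A : Formula α) :
      GKPrem (Γ, A ::ₘ Δ) (A.neg ::ₘ Γ, Δ)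
  | boxK (i : α) (Γ : Multiset (Formula α)) (A : Formula α)
      (Sg Ω : Multiset (Formula α)) :
      (∀ C ∈ Sg, C.isAtomic ∨ C.isBoxedNe i) →
      (∀ C ∈ Ω, C.isAtomic ∨ C.isBoxed) →
      GKPrem (Γ, {A}) (Sg + Γ.map (Formula.box i), Formula.box i A ::ₘ Ω)

/-- The sequent calculus `G(KT_n⁺)` on T-sequents `Σ | Γ ⇒ Δ`. -/
inductive GT {α : Type} :
    Multiset (Formula α) → Multiset (Formula α) → Multiset (Formula α) → Prop
  | axId (Sg : Multiset (Formula α)) (p : ℕ) (Γ Δ : Multiset (Formula α)) :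
      GT Sg (Formula.var p ::ₘ Γ) (Formula.var p ::ₘ Δ)
  | axBot (Sg Γ Δ : Multiset (Formula α)) : GT Sg (Formula.bot ::ₘ Γ) Δ
  | andR {Sg Γ Δ : Multiset (Formula α)} {A B : Formula α} :
      GT Sg Γ (A ::ₘ Δ) → GT Sg Γ (B ::ₘ Δ) → GT Sg Γ (A.and B ::ₘ Δ)
  | andL {Sg Γ Δ : Multiset (Formula α)} {A B : Formula α} :
      GT Sg (A ::ₘ B ::ₘ Γ) Δ → GT Sg (A.and B ::ₘ Γ) Δ
  | orR {Sg Γ Δ : Multiset (Formula α)} {A B : Formula α} :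
      GT Sg Γ (A ::ₘ B ::ₘ Δ) → GT Sg Γ (A.or B ::ₘ Δ)
  | orL {Sg Γ Δ : Multiset (Formula α)} {A B : Formula α} :
      GT Sg (A ::ₘ Γ) Δ → GT Sg (B ::ₘ Γ) Δ → GT Sg (A.or B ::ₘ Γ) Δ
  | impR {Sg Γ Δ : Multiset (Formula α)} {A B : Formula α} :
      GT Sg (A ::ₘ Γ) (B ::ₘ Δ) → GT Sg Γ (A.imp B ::ₘ Δ)
  | impL {Sg Γ Δ : Multiset (Formula α)} {A B : Formula α} :
      GT Sg Γ (A ::ₘ Δ) → GT Sg (B ::ₘ Γ) Δ → GT Sg (A.imp B ::ₘ Γ) Δ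
  | negR {Sg Γ Δ : Multiset (Formula α)} {A : Formula α} :
      GT Sg (A ::ₘ Γ) Δ → GT Sg Γ (A.neg ::ₘ Δ)
  | negL {Sg Γ Δ : Multiset (Formula α)} {A : Formula α} :
      GT Sg Γ (A ::ₘ Δ) → GT Sg (A.neg ::ₘ Γ) Δ
  | boxK (i : α) {Γ : Multiset (Formula α)} {A : Formula α}
      (Sg Pis Ω : Multiset (Formula α)) :
      (∀ C ∈ Sg, C.isBoxedNe i) →
      (∀ C ∈ Pis, C.isAtomic) →
      (∀ C ∈ Ω, C.isAtomic ∨ C.isBoxed) →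
      GT 0 Γ {A} →
      GT (Sg + Γ.map (Formula.box i)) Pis (Formula.box i A ::ₘ Ω)
  | boxT (i : α) {Sg Γ Δ : Multiset (Formula α)} {A : Formula α} :
      GT (Formula.box i A ::ₘ Sg) (A ::ₘ Γ) Δ →
      GT Sg (Formula.box i A ::ₘ Γ) Δ

/-- The premise-of relation for backward proof-search in `G(KT_n⁺)`. -/
inductive TPrem {α : Type} :
    Multiset (Formula α) × Multiset (Formula α) × Multiset (Formula α) →
    Multiset (Formula α) × Multiset (Formula α) × Multiset (Formula α) → Prop
  | andR1 (Sg Γ Δ : Multiset (Formula α)) (A B : Formula α) :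
      TPrem (Sg, Γ, A ::ₘ Δ) (Sg, Γ, A.and B ::ₘ Δ)
  | andR2 (Sg Γ Δ : Multiset (Formula α)) (A B : Formula α) :
      TPrem (Sg, Γ, B ::ₘ Δ) (Sg, Γ, A.and B ::ₘ Δ)
  | andL (Sg Γ Δ : Multiset (Formula α)) (A B : Formula α) :
      TPrem (Sg, A ::ₘ B ::ₘ Γ, Δ) (Sg, A.and B ::ₘ Γ, Δ)
  | orR (Sg Γ Δ : Multiset (Formula α)) (A B : Formula α) :
      TPrem (Sg, Γ, A ::ₘ B ::ₘ Δ) (Sg, Γ, A.or B ::ₘ Δ)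
  | orL1 (Sg Γ Δ : Multiset (Formula α)) (A B : Formula α) :
      TPrem (Sg, A ::ₘ Γ, Δ) (Sg, A.or B ::ₘ Γ, Δ)
  | orL2 (Sg Γ Δ : Multiset (Formula α)) (A B : Formula α) :
      TPrem (Sg, B ::ₘ Γ, Δ) (Sg, A.or B ::ₘ Γ, Δ)
  | impR (Sg Γ Δ : Multiset (Formula α)) (A B : Formula α) :
      TPrem (Sg, A ::ₘ Γ, B ::ₘ Δ) (Sg, Γ, A.imp B ::ₘ Δ)
  | impL1 (Sg Γ Δ : Multiset (Formula α)) (A B : Formula α) :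
      TPrem (Sg, Γ, A ::ₘ Δ) (Sg, A.imp B ::ₘ Γ, Δ)
  | impL2 (Sg Γ Δ : Multiset (Formula α)) (A B : Formula α) :
      TPrem (Sg, B ::ₘ Γ, Δ) (Sg, A.imp B ::ₘ Γ, Δ)
  | negR (Sg Γ Δ : Multiset (Formula α)) (A : Formula α) :
      TPrem (Sg, A ::ₘ Γ, Δ) (Sg, Γ, A.neg ::ₘ Δ)
  | negL (Sg Γ Δ : Multiset (Formula α)) (A : Formula α) :
      TPrem (Sg, Γ, A ::ₘ Δ) (Sg, A.neg ::ₘ Γ, Δ)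
  | boxK (i : α) (Γ : Multiset (Formula α)) (A : Formula α)
      (Sg Pis Ω : Multiset (Formula α)) :
      (∀ C ∈ Sg, C.isBoxedNe i) →
      (∀ C ∈ Pis, C.isAtomic) →
      (∀ C ∈ Ω, C.isAtomic ∨ C.isBoxed) →
      TPrem (0, Γ, {A}) (Sg + Γ.map (Formula.box i), Pis, Formula.box i A ::ₘ Ω)
  | boxT (i : α) (Sg Γ Δ : Multiset (Formula α)) (A : Formula α) :
      TPrem (Formula.box i A ::ₘ Sg, A ::ₘ Γ, Δ) (Sg, Formula.box i A ::ₘ Γ, Δ)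

/-- The termination measure `⟨b(Σ,Γ,Δ), wt(Γ,Δ)⟩` on T-sequents. -/
def tMeasure {α : Type} [DecidableEq α]
    (s : Multiset (Formula α) × Multiset (Formula α) × Multiset (Formula α)) :
    ℕ × ℕ :=
  (bCount (s.1 + s.2.1 + s.2.2), mWt s.2.1 + mWt s.2.2)

end UIP

namespace UIP

/-- Well-founded trees presenting serial Kripke models:
a leaf is a single reflexive point falsifying every variable, and every other
point has at least one successor for each agent. -/
inductive SerialTree (α : Type) : Type where
  | leaf : SerialTree α
  | node : (ℕ → Prop) → (α → Formula α → SerialTree α) → SerialTree α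

namespace SerialTree

variable {α : Type}

/-- The valuation at the root. -/
def val : SerialTree α → ℕ → Prop
  | leaf, _ => False
  | node v _, p => v p

/-- The accessibility relation of agent `i`. -/
def Rel (i : α) : SerialTree α → SerialTree α → Prop
  | leaf, s => s = leaf
  | node _ c, s => ∃ A, c i A = s

theorem exists_rel (i : α) : ∀ t : SerialTree α, ∃ s, Rel i t s
  | leaf => ⟨leaf, rfl⟩
  | node _ _ => ⟨_, Formula.bot, rfl⟩

/-- Truth of a formula at the root. -/
def Sat : SerialTree α → Formula α → Prop
  | t, .var p => t.val p
  | _, .bot => False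
  | t, .and A B => Sat t A ∧ Sat t B
  | t, .or A B => Sat t A ∨ Sat t B
  | t, .imp A B => Sat t A → Sat t B
  | t, .neg A => ¬ Sat t A
  | t, .box i A => ∀ s, Rel i t s → Sat s A

end SerialTree

variable {α : Type}

/-- Validity of the sequent `Γ ⇒ Δ` in all serial trees. -/
def Valid (Γ Δ : Multiset (Formula α)) : Prop :=
  ∀ t : SerialTree α, (∀ A ∈ Γ, t.Sat A) → ∃ B ∈ Δ, t.Sat B

theorem G.valid {Γ Δ : Multiset (Formula α)} (h : G true false Γ Δ) : Valid Γ Δ := by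
  induction h with
  | boxK i Sg Ω _ _ _ ih =>
    intro t ht
    refine ⟨_, Multiset.mem_cons_self _ _, fun s hs => ?_⟩
    obtain ⟨B, hB, hsB⟩ := ih s fun C hC =>
      ht (.box i C) (Multiset.mem_add.2 (.inr (Multiset.mem_map_of_mem _ hC))) s hs
    rwa [← Multiset.mem_singleton.1 hB]
  | boxD i Sg Ω _ _ _ _ _ ih =>
    intro t ht
    obtain ⟨s, hs⟩ := t.exists_rel i
    obtain ⟨B, hB, -⟩ := ih s fun C hC =>
      ht (.box i C) (Multiset.mem_add.2 (.inr (Multiset.mem_map_of_mem _ hC))) s hs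
    exact absurd hB (Multiset.notMem_zero B)
  | boxT _ h => cases h
  | _ =>
    intro t
    simp_all only [Valid, Multiset.mem_cons, forall_eq_or_imp, exists_eq_or_imp, SerialTree.Sat]
    grind

theorem exists_eq_add_map_box (i : α) (Γ : Multiset (Formula α))
    (h : ∀ C ∈ Γ, C.isAtomic ∨ C.isBoxed) :
    ∃ Sg Γi : Multiset (Formula α), Γ = Sg + Γi.map (Formula.box i) ∧
      ∀ C ∈ Sg, C.isAtomic ∨ C.isBoxedNe i := by
  induction Γ using Multiset.induction with
  | empty => exact ⟨0, 0, by simp⟩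
  | cons C Γ ih =>
    obtain ⟨Sg, Γi, rfl, hSg⟩ := ih fun D hD => h D (Multiset.mem_cons_of_mem hD)
    by_cases hC : ∃ A, C = .box i A
    · obtain ⟨A, rfl⟩ := hC
      exact ⟨Sg, A ::ₘ Γi, by simp, hSg⟩
    · refine ⟨C ::ₘ Sg, Γi, by simp, fun D hD => ?_⟩
      obtain rfl | hD := Multiset.mem_cons.1 hD
      · refine (h D (Multiset.mem_cons_self _ _)).imp_right fun hb => ?_
        cases D <;> simp_all [Formula.isBoxed, Formula.isBoxedNe]
      · exact hSg D hD

@[simp] theorem mWt_zero : mWt (0 : Multiset (Formula α)) = 0 := rfl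

@[simp] theorem mWt_cons (A : Formula α) (Γ : Multiset (Formula α)) :
    mWt (A ::ₘ Γ) = A.weight + mWt Γ := by
  simp [mWt]

@[simp] theorem mWt_add (Γ Δ : Multiset (Formula α)) : mWt (Γ + Δ) = mWt Γ + mWt Δ := by
  simp [mWt]

@[simp] theorem mWt_map_box (i : α) (Γ : Multiset (Formula α)) :
    mWt (Γ.map (Formula.box i)) = mWt Γ + Γ.card := by
  simp [mWt, Function.comp_def, Formula.weight, Multiset.sum_map_add]

/-- Completeness for sequents of atomic and boxed formulas, given completeness for
lighter sequents. -/
theorem Valid.derivable_of_atomic_or_boxed {Γ Δ : Multiset (Formula α)}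
    (ih : ∀ Γ' Δ' : Multiset (Formula α), mWt Γ' + mWt Δ' < mWt Γ + mWt Δ → Valid Γ' Δ' → G true false Γ' Δ')
    (hΓ : ∀ C ∈ Γ, C.isAtomic ∨ C.isBoxed) (hΔ : ∀ C ∈ Δ, C.isAtomic ∨ C.isBoxed)
    (h : Valid Γ Δ) : G true false Γ Δ := by
  by_contra hG
  have key : ∀ (i : α) (A : Formula α), ∃ s : SerialTree α,
      (∀ C, .box i C ∈ Γ → s.Sat C) ∧ (.box i A ∈ Δ → ¬ s.Sat A) := by
    intro i A
    obtain ⟨Sg, Γi, hΓi, hSg⟩ := exists_eq_add_map_box i Γ hΓ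
    have hmem : ∀ C, .box i C ∈ Γ → C ∈ Γi := by
      intro C hC
      rw [hΓi, Multiset.mem_add] at hC
      rcases hC with hC | hC
      · simpa [Formula.isAtomic, Formula.isBoxedNe] using hSg _ hC
      · simpa using hC
    have hw : mWt Γ = mWt Sg + (mWt Γi + Γi.card) := by simp [hΓi]
    by_cases hA : .box i A ∈ Δ
    · obtain ⟨Ω, rfl⟩ := Multiset.exists_cons_of_mem hA
      have hv : ¬ Valid Γi {A} := fun hv => hG <| by
        rw [hΓi]
        refine .boxK i Sg Ω hSg (fun C hC => hΔ C (Multiset.mem_cons_of_mem hC)) (ih _ _ ?_ hv)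
        simp [← Multiset.cons_zero, hw, Formula.weight]
        omega
      simp only [Valid, not_forall, not_exists, not_and] at hv
      obtain ⟨s, hs, hsA⟩ := hv
      exact ⟨s, fun C hC => hs C (hmem C hC), fun _ => hsA A (Multiset.mem_singleton_self A)⟩
    · by_cases hΓi0 : Γi = 0
      · exact ⟨.leaf, fun C hC => by simpa [hΓi0] using hmem C hC, fun h => absurd h hA⟩
      have hv : ¬ Valid Γi 0 := fun hv => hG <| by
        rw [hΓi]
        refine .boxD i Sg Δ rfl hΓi0 hSg hΔ (ih _ _ ?_ hv)
        have := Multiset.card_pos.2 hΓi0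
        simp only [hw, mWt_zero]
        omega
      simp only [Valid, not_forall] at hv
      obtain ⟨s, hs, -⟩ := hv
      exact ⟨s, fun C hC => hs C (hmem C hC), fun h => absurd h hA⟩
  choose c hcΓ hcΔ using key
  obtain ⟨B, hB, hsB⟩ := h (.node (fun p => .var p ∈ Γ) c) fun C hC => by
    cases C with
    | var p => exact hC
    | bot =>
      obtain ⟨Γ', rfl⟩ := Multiset.exists_cons_of_mem hC
      exact absurd (.axBot _ _) hG
    | box i A =>
      rintro _ ⟨D, rfl⟩
      exact hcΓ i D A hC
    | _ => simpa [Formula.isAtomic, Formula.isBoxed] using hΓ _ hC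
  cases B with
  | var p =>
    obtain ⟨Γ', rfl⟩ := Multiset.exists_cons_of_mem (show .var p ∈ Γ from hsB)
    obtain ⟨Δ', rfl⟩ := Multiset.exists_cons_of_mem hB
    exact hG (.axId _ _ _)
  | bot => exact hsB
  | box i A => exact hcΔ i A hB (hsB _ ⟨A, rfl⟩)
  | _ => simpa [Formula.isAtomic, Formula.isBoxed] using hΔ _ hB

theorem Valid.derivable {Γ Δ : Multiset (Formula α)} (h : Valid Γ Δ) : G true false Γ Δ := by
  induction hn : mWt Γ + mWt Δ using Nat.strong_induction_on generalizing Γ Δ with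
  | _ n ih =>
  subst hn
  replace ih : ∀ Γ' Δ', mWt Γ' + mWt Δ' < mWt Γ + mWt Δ → Valid Γ' Δ' → G true false Γ' Δ' :=
    fun _ _ hlt hv => ih _ hlt hv rfl
  by_cases hΓ : ∀ C ∈ Γ, C.isAtomic ∨ C.isBoxed
  · by_cases hΔ : ∀ C ∈ Δ, C.isAtomic ∨ C.isBoxed
    · exact h.derivable_of_atomic_or_boxed ih hΓ hΔ
    · push Not at hΔ
      obtain ⟨C, hC, hCa, hCb⟩ := hΔ
      obtain ⟨Δ, rfl⟩ := Multiset.exists_cons_of_mem hC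
      cases C with
      | var | bot => exact absurd trivial hCa
      | box => exact absurd trivial hCb
      | and | or | imp | neg =>
        first | apply G.andR | apply G.orR | apply G.impR | apply G.negR
        all_goals
          apply ih
          · simp only [mWt_cons, Formula.weight]
            omega
          · intro t
            have := h t
            simp only [Multiset.mem_cons, forall_eq_or_imp, exists_eq_or_imp, SerialTree.Sat] at this ⊢
            tauto
  · push Not at hΓ
    obtain ⟨C, hC, hCa, hCb⟩ := hΓ
    obtain ⟨Γ, rfl⟩ := Multiset.exists_cons_of_mem hC
    cases C with
    | var | bot => exact absurd trivial hCa
    | box => exact absurd trivial hCb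
    | and | or | imp | neg =>
      first | apply G.andL | apply G.orL | apply G.impL | apply G.negL
      all_goals
        apply ih
        · simp only [mWt_cons, Formula.weight]
          omega
        · intro t
          have := h t
          simp only [Multiset.mem_cons, forall_eq_or_imp, exists_eq_or_imp, SerialTree.Sat] at this ⊢
          tauto

theorem Valid.cut {Γ Δ Γ' Δ' : Multiset (Formula α)} {A : Formula α}
    (h1 : Valid Γ (A ::ₘ Δ)) (h2 : Valid (A ::ₘ Γ') Δ') : Valid (Γ + Γ') (Δ + Δ') := by
  intro t ht
  simp only [Multiset.mem_add, or_imp, forall_and] at ht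
  obtain ⟨B, hB, hsB⟩ := h1 t ht.1
  obtain rfl | hB := Multiset.mem_cons.1 hB
  · obtain ⟨C, hC, hsC⟩ := h2 t (Multiset.forall_mem_cons.2 ⟨hsB, ht.2⟩)
    exact ⟨C, Multiset.mem_add.2 (.inr hC), hsC⟩
  · exact ⟨B, Multiset.mem_add.2 (.inl hB), hsB⟩

end UIP

open UIP Formula

/-- the cut rule is admissible in `G(KD_n)`. -/
theorem GKDn_cut_admissible {α : Type} [Fintype α]
    (Γ Δ Γ' Δ' : Multiset (Formula α)) (A : Formula α)
    (h1 : G true false Γ (A ::ₘ Δ)) (h2 : G true false (A ::ₘ Γ') Δ') :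
    G true false (Γ + Γ') (Δ + Δ') :=
  (h1.valid.cut h2.valid).derivable
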